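/- arXiv:math/9903018 — 4 statements merged into one kernel-verified Lean document; each statement's English description precedes it below -/
import Mathlib

section
/- Let 𝔭 ∈ 𝔓_D and i ∈ {0,…,n−1} be such that 𝔭^{-1}(i+1) = ∅. Fix a partition of 𝔭^{-1}(i) into pairwise disjoint subsets J, K_1, …, K_t such that each K_s = {k_s, l_s} with k_s < l_s has exactly two elements, no element of J lies in the interval [k_s, l_s], and for s ≠ s′ the intervals [k_s, l_s] and [k_{s′}, l_{s′}] are either disjoint or one is contained in the other. For 0 ≤ l ≤ #J let 𝔭_l ∈ 𝔓_D be defined by: 𝔭_l(j) = 𝔭(j) for all j not congruent mod D to an element of 𝔭^{-1}(i); 𝔭_l takes the value i+1 at the l smallest elements of J and the value i at the remaining elements of J; 𝔭_l(k_s) = i and 𝔭_l(l_s) = i+1 for each s; these values are extended by 𝔭_l(k+mD) = 𝔭_l(k) + mn. (Then J, K_1, …, K_t is an admissible partition of 𝔭_l^{-1}({i,i+1}), so ⟨𝔭_l⟩ ∈ T_D is defined.) Then for all 0 ≤ l ≤ #J one has E_i(⟨𝔭_l⟩) = [#J − l + 1]·⟨𝔭_{l−1}⟩, with the convention ⟨𝔭_{−1}⟩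 = 0. -/
open LaurentPolynomial

open scoped Classical

noncomputable section

/-- `T_D`: the free module over `ℤ[v,v⁻¹]` with basis indexed by functions `ℤ → ℤ`
(only basis elements `[𝔭]` with `𝔭 ∈ 𝔓_D` are used). -/
abbrev TD := (ℤ → ℤ) →₀ LaurentPolynomial ℤ

/-- The basis element `[𝔭]`. -/
def bas (p : ℤ → ℤ) : TD := Finsupp.single p 1

/-- Membership in `𝔓_D`. -/
def IsPD (n D : ℕ) (p : ℤ → ℤ) : Prop := ∀ j : ℤ, p (j + D) = p j + n

/-- `𝔭_k^ε` : the value is shifted by `ε` on the congruence class of `k` mod `D`. -/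
def pShift (D : ℕ) (p : ℤ → ℤ) (k ε j : ℤ) : ℤ := if (D : ℤ) ∣ (j - k) then p j + ε else p j

/-- The exponent `e(𝔭,k)` in the formula for `E_i`. -/
def ecoef (p : ℤ → ℤ) (i k : ℤ) : ℤ :=
  ({l : ℤ | p l = i + 1 ∧ k < l}.ncard : ℤ) - ({l : ℤ | p l = i ∧ k < l}.ncard : ℤ)

/-- The operator `E_i` on `T_D`. -/
def Eop (D : ℕ) (i : ℤ) (x : TD) : TD :=
  x.sum fun p c =>
    ∑ᶠ k ∈ {k : ℤ | p k = i + 1}, (c * T (ecoef p i k)) • bas (pShift D p k (-1))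

/-- `𝔭_{A,B}`, encoded through the set `Up` of elements of `𝔭⁻¹({i,i+1})` where the new
value is `i+1` : the value is raised by 1 on congruence classes of points of `Up` with value `i`,
and lowered by 1 on congruence classes of points with value `i+1` not belonging to `Up`. -/
def pAB (D : ℕ) (p : ℤ → ℤ) (i : ℤ) (Up : Set ℤ) (j : ℤ) : ℤ :=
  p j + (if ∃ k ∈ Up, p k = i ∧ (D : ℤ) ∣ (j - k) then 1 else 0)
      - (if ∃ k, p k = i + 1 ∧ k ∉ Up ∧ (D : ℤ) ∣ (j - k) then 1 else 0)

/-- The set of points of `𝔭⁻¹({i,i+1})` receiving the value `i+1` in `𝔭_{A,B}`: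
all of `A`, the minima of the pairs `K_s` with `s ∈ B`, the maxima of the pairs `K_s`
with `s ∉ B`. -/
def UpSet {t : ℕ} (A : Finset ℤ) (B : Finset (Fin t)) (K : Fin t → ℤ × ℤ) : Set ℤ :=
  ↑A ∪ {x | ∃ s ∈ B, x = (K s).1} ∪ {x | ∃ s, s ∉ B ∧ x = (K s).2}

/-- `n_A = #{(k,l) ∈ A × (J∖A) : k > l}`. -/
def nA (J A : Finset ℤ) : ℕ := ((A ×ˢ (J \ A)).filter fun q => q.2 < q.1).card

/-- `⟨𝔭⟩`, relative to an admissible partition `J, K_1, …, K_t` of `𝔭⁻¹({i,i+1})`. -/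
def bracket (D : ℕ) (p : ℤ → ℤ) (i : ℤ) (J : Finset ℤ) {t : ℕ} (K : Fin t → ℤ × ℤ) : TD :=
  ∑ A ∈ J.powerset.filter (fun A => A.card = (J.filter fun x => p x = i + 1).card),
    ∑ B : Finset (Fin t),
      ((T (nA J A : ℤ) : LaurentPolynomial ℤ) * (-T 1) ^ B.card) • bas (pAB D p i (UpSet A B K))

/-- The `l` smallest elements of a finite set of integers. -/
def smallest (J : Finset ℤ) (l : ℕ) : Finset ℤ := ((J.sort (· ≤ ·)).take l).toFinset

/-- The flag `𝔭_l` : starting from `𝔭` with `𝔭⁻¹(i+1) = ∅` and a partition `J, K_1, …, K_t`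
of `𝔭⁻¹(i)`, raise the value to `i+1` at the `l` smallest elements of `J` and at the maxima
of all the pairs `K_s`. -/
def pl (D : ℕ) (p : ℤ → ℤ) (i : ℤ) (J : Finset ℤ) {t : ℕ} (K : Fin t → ℤ × ℤ) (l : ℕ) :
    ℤ → ℤ :=
  pAB D p i (↑(smallest J l) ∪ {x | ∃ s, x = (K s).2})

/-- The quantum integer `[s] = v^{s-1} + v^{s-3} + ⋯ + v^{1-s}`. -/
def qInt (s : ℕ) : LaurentPolynomial ℤ :=
  ∑ j ∈ Finset.range s, T ((s : ℤ) - 1 - 2 * j)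

def fE (D : ℕ) (i : ℤ) (p : ℤ → ℤ) : TD :=
  ∑ᶠ k ∈ {k : ℤ | p k = i + 1}, (T (ecoef p i k) : LaurentPolynomial ℤ) • bas (pShift D p k (-1))

lemma Eop_eq (D : ℕ) (i : ℤ) (x : TD) :
    Eop D i x = Finsupp.linearCombination (LaurentPolynomial ℤ) (fE D i) x := by
  rw [Finsupp.linearCombination_apply]
  unfold Eop
  congr 1
  funext p c
  unfold fE
  rw [smul_finsum]
  congr 1
  funext k
  rw [smul_finsum]
  congr 1
  funext _
  rw [mul_smul]

lemma Eop_sum {ι : Type*} (D : ℕ) (i : ℤ) (S : Finset ι) (x : ι → TD) :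
    Eop D i (∑ a ∈ S, x a) = ∑ a ∈ S, Eop D i (x a) := by
  simp only [Eop_eq, map_sum]

lemma Eop_smul_bas (D : ℕ) (i : ℤ) (c : LaurentPolynomial ℤ) (q : ℤ → ℤ) :
    Eop D i (c • bas q) = c • fE D i q := by
  simp [Eop_eq, bas]

section comb

lemma per {n D : ℕ} {p : ℤ → ℤ} (hp : IsPD n D p) (j m : ℤ) : p (j + D * m) = p j + n * m := by
  induction m using Int.induction_on with
  | zero => simp
  | succ m ih =>
    have := hp (j + D * m)
    rw [show j + D * ((m : ℤ) + 1) = j + D * m + D by ring, this, ih]; ring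
  | pred m ih =>
    have := hp (j + D * (-m - 1))
    rw [show j + D * (-(m : ℤ) - 1) + D = j + D * (-m) by ring, ih] at this
    linarith

lemma same {n D : ℕ} (hn : 0 < n) {p : ℤ → ℤ} (hp : IsPD n D p) {x k : ℤ}
    (h : (D : ℤ) ∣ x - k) (hx : p x = p k) : x = k := by
  obtain ⟨m, hm⟩ := h
  have h1 := per hp k m
  rw [show k + D * m = x by linarith, hx] at h1
  have : (n : ℤ) * m = 0 := by linarith
  have hm0 : m = 0 := by
    rcases mul_eq_zero.1 this with h | h
    · omega
    · exact h
  subst hm0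
  linarith

variable {n D : ℕ} (hn : 0 < n) {p : ℤ → ℤ} (hp : IsPD n D p) {i : ℤ}
  (hempty : ∀ k : ℤ, p k ≠ i + 1)

include hempty in
lemma q_apply {U : Set ℤ} (hU : ∀ x ∈ U, p x = i) (x : ℤ) :
    pAB D p i U x = p x + if ∃ k ∈ U, (D : ℤ) ∣ (x - k) then 1 else 0 := by
  unfold pAB
  rw [if_neg (c := ∃ k, p k = i + 1 ∧ k ∉ U ∧ (D : ℤ) ∣ (x - k))]
  · have : (∃ k ∈ U, p k = i ∧ (D : ℤ) ∣ (x - k)) ↔ ∃ k ∈ U, (D : ℤ) ∣ (x - k) :=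
      ⟨fun ⟨k, a, b, c⟩ => ⟨k, a, c⟩, fun ⟨k, a, c⟩ => ⟨k, a, hU k a, c⟩⟩
    simp only [this]; ring
  · rintro ⟨k, hk, _⟩; exact hempty k hk

include hn hp hempty in
lemma q_eq_succ {U : Set ℤ} (hU : ∀ x ∈ U, p x = i) (x : ℤ) :
    pAB D p i U x = i + 1 ↔ x ∈ U := by
  rw [q_apply hempty hU]
  constructor
  · intro h
    split_ifs at h with h1
    · obtain ⟨k, hk, hd⟩ := h1
      have : p x = p k := by rw [hU k hk]; linarith
      rw [same hn hp hd this]; exact hk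
    · exact absurd (by linarith) (hempty x)
  · intro h
    rw [if_pos ⟨x, h, by simp⟩, hU x h]

include hn hp hempty in
lemma q_eq {U : Set ℤ} (hU : ∀ x ∈ U, p x = i) (x : ℤ) :
    pAB D p i U x = i ↔ p x = i ∧ x ∉ U := by
  rw [q_apply hempty hU]
  constructor
  · intro h
    split_ifs at h with h1
    · obtain ⟨k, hk, m, hm⟩ := h1
      have h2 := per hp k m
      rw [show k + D * m = x by linarith, hU k hk] at h2
      have h3 : (n : ℤ) * (-m) = 1 := by linarith
      have h4 : (n : ℤ) = 1 := Int.eq_one_of_mul_eq_one_right (by omega) h3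
      have h5 := hp k
      rw [hU k hk, h4] at h5
      exact absurd h5 (hempty _)
    · refine ⟨by linarith, fun hx => h1 ⟨x, hx, by simp⟩⟩
  · rintro ⟨h1, h2⟩
    rw [if_neg, h1, add_zero]
    rintro ⟨k, hk, hd⟩
    rw [same hn hp hd (by rw [h1, hU k hk])] at h2
    exact h2 hk

include hn hp hempty in
lemma q_q {U V : Set ℤ} (hU : ∀ x ∈ U, p x = i) (hV : ∀ x ∈ V, p x = i) :
    pAB D (pAB D p i U) i V = pAB D p i V := by
  funext x
  rw [q_apply hempty hV]
  rw [show pAB D (pAB D p i U) i V x = pAB D p i U x +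
      (if ∃ k ∈ V, pAB D p i U k = i ∧ (D : ℤ) ∣ (x - k) then 1 else 0)
      - (if ∃ k, pAB D p i U k = i + 1 ∧ k ∉ V ∧ (D : ℤ) ∣ (x - k) then 1 else 0) from rfl]
  simp only [q_eq_succ hn hp hempty hU, q_eq hn hp hempty hU]
  rw [q_apply hempty hU]
  have uniq : ∀ k k', p k = i → p k' = i → (D : ℤ) ∣ x - k → (D : ℤ) ∣ x - k' → k = k' := by
    intro k k' h h' hd hd'
    refine same hn hp ?_ (h.trans h'.symm)
    have := dvd_sub hd' hd
    rwa [show x - k' - (x - k) = k - k' by ring] at this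
  by_cases hx : ∃ k, p k = i ∧ (D : ℤ) ∣ x - k
  · obtain ⟨k, hk, hd⟩ := hx
    have e1 : (∃ k ∈ U, (D : ℤ) ∣ x - k) ↔ k ∈ U :=
      ⟨fun ⟨k', a, b⟩ => uniq k' k (hU _ a) hk b hd ▸ a, fun h => ⟨k, h, hd⟩⟩
    have e2 : (∃ k ∈ V, (D : ℤ) ∣ x - k) ↔ k ∈ V :=
      ⟨fun ⟨k', a, b⟩ => uniq k' k (hV _ a) hk b hd ▸ a, fun h => ⟨k, h, hd⟩⟩
    have e3 : (∃ k ∈ V, (p k = i ∧ k ∉ U) ∧ (D : ℤ) ∣ x - k) ↔ k ∈ V ∧ k ∉ U :=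
      ⟨fun ⟨k', a, c, b⟩ => uniq k' k (hV _ a) hk b hd ▸ ⟨a, c.2⟩,
        fun h => ⟨k, h.1, ⟨hk, h.2⟩, hd⟩⟩
    have e4 : (∃ k ∈ U, k ∉ V ∧ (D : ℤ) ∣ x - k) ↔ k ∈ U ∧ k ∉ V :=
      ⟨fun ⟨k', a, c, b⟩ => uniq k' k (hU _ a) hk b hd ▸ ⟨a, c⟩,
        fun h => ⟨k, h.1, h.2, hd⟩⟩
    simp only [e1, e2, e3, e4]
    by_cases h1 : k ∈ U <;> by_cases h2 : k ∈ V <;> simp [h1, h2]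
  · push Not at hx
    rw [if_neg, if_neg, if_neg, if_neg]
    · ring
    · rintro ⟨k, a, b⟩; exact hx k (hV k a) b
    · rintro ⟨k, a, _, b⟩; exact hx k (hU k a) b
    · rintro ⟨k, a, _, b⟩; exact hx k (hV k a) b
    · rintro ⟨k, a, b⟩; exact hx k (hU k a) b

include hn hp hempty in
lemma q_shift {U : Finset ℤ} (hU : ∀ x ∈ U, p x = i) {k : ℤ} (hk : k ∈ U) :
    pShift D (pAB D p i (U : Set ℤ)) k (-1) = pAB D p i ((U.erase k : Finset ℤ) : Set ℤ) := by
  funext x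
  unfold pShift
  rw [q_apply hempty (by simpa using hU),
    q_apply hempty (U := ((U.erase k : Finset ℤ) : Set ℤ))
      (by intro x hx; exact hU x (Finset.mem_of_mem_erase (by exact_mod_cast hx)))]
  by_cases hd : (D : ℤ) ∣ x - k
  · rw [if_pos hd, if_pos ⟨k, by simpa using hk, hd⟩, if_neg]
    · ring
    · rintro ⟨k', a, b⟩
      have a' : k' ≠ k ∧ k' ∈ U := Finset.mem_erase.1 (Finset.mem_coe.1 a)
      apply a'.1
      refine same hn hp ?_ ((hU _ a'.2).trans (hU _ hk).symm)
      have := dvd_sub hd b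
      rwa [show x - k - (x - k') = k' - k by ring] at this
  · rw [if_neg hd]
    congr 2
    apply propext
    constructor
    · rintro ⟨k', a, b⟩
      refine ⟨k', ?_, b⟩
      have : k' ≠ k := by rintro rfl; exact hd b
      exact Finset.mem_coe.2 (Finset.mem_erase.2 ⟨this, Finset.mem_coe.1 a⟩)
    · rintro ⟨k', a, b⟩
      have a' : k' ≠ k ∧ k' ∈ U := Finset.mem_erase.1 (Finset.mem_coe.1 a)
      exact ⟨k', by simpa using a'.2, b⟩

/-- signed count -/
def sg (P U : Finset ℤ) (k : ℤ) : ℤ :=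
  ∑ x ∈ P, if k < x then (if x ∈ U then 1 else -1) else 0

include hn hp hempty in
lemma q_ecoef {P U : Finset ℤ} (hP : ∀ x, p x = i ↔ x ∈ P) (hU : U ⊆ P) (k : ℤ) :
    ecoef (pAB D p i (U : Set ℤ)) i k = sg P U k := by
  have hU' : ∀ x ∈ (U : Set ℤ), p x = i := fun x hx => (hP x).2 (hU (by exact_mod_cast hx))
  unfold ecoef
  simp only [q_eq_succ hn hp hempty hU', q_eq hn hp hempty hU']
  have e1 : {l : ℤ | l ∈ (U : Set ℤ) ∧ k < l} = ((P.filter fun x => k < x ∧ x ∈ U : Finset ℤ) : Set ℤ) := by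
    ext x
    simp only [Set.mem_ofPred_eq, Finset.coe_filter, Finset.mem_coe]
    exact ⟨fun h => ⟨hU h.1, h.2, h.1⟩, fun h => ⟨h.2.2, h.2.1⟩⟩
  have e2 : {l : ℤ | (p l = i ∧ l ∉ (U : Set ℤ)) ∧ k < l}
      = ((P.filter fun x => k < x ∧ x ∉ U : Finset ℤ) : Set ℤ) := by
    ext x
    simp only [Set.mem_ofPred_eq, Finset.coe_filter, Finset.mem_coe, hP]
    tauto
  rw [e1, e2, Set.ncard_coe_finset, Set.ncard_coe_finset, Finset.card_filter, Finset.card_filter]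
  push_cast
  rw [← Finset.sum_sub_distrib]
  unfold sg
  refine Finset.sum_congr rfl fun x _ => ?_
  by_cases h1 : k < x <;> by_cases h2 : x ∈ U <;> simp [h1, h2]

include hn hp hempty in
lemma fE_q {P U : Finset ℤ} (hP : ∀ x, p x = i ↔ x ∈ P) (hU : U ⊆ P) :
    fE D i (pAB D p i (U : Set ℤ)) =
      ∑ k ∈ U, (T (sg P U k) : LaurentPolynomial ℤ) •
        bas (pAB D p i ((U.erase k : Finset ℤ) : Set ℤ)) := by
  have hU' : ∀ x ∈ (U : Set ℤ), p x = i := fun x hx => (hP x).2 (hU (by exact_mod_cast hx))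
  unfold fE
  simp only [Set.mem_ofPred_eq, q_eq_succ hn hp hempty hU', q_ecoef hn hp hempty hP hU]
  rw [finsum_mem_coe_finset]
  refine Finset.sum_congr rfl fun k hk => ?_
  rw [q_shift hn hp hempty (fun x hx => hU' x (by exact_mod_cast hx)) hk]

end comb

lemma qInt_succ (s : ℕ) : qInt (s + 1) = T (s : ℤ) + T (-1) * qInt s := by
  unfold qInt
  rw [Finset.sum_range_succ', Finset.mul_sum, add_comm]
  congr 1
  · congr 1; push_cast; ring
  · refine Finset.sum_congr rfl fun j _ => ?_
    rw [← T_add]; congr 1; push_cast; ring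

lemma sum_qInt (M : Finset ℤ) :
    ∑ k ∈ M, (T (((M.filter (· < k)).card : ℤ) - ((M.filter (k < ·)).card : ℤ)) :
      LaurentPolynomial ℤ) = qInt M.card := by
  induction M using Finset.induction_on_max with
  | empty => simp [qInt]
  | insert m M hm ih =>
    have hmM : m ∉ M := fun h => lt_irrefl _ (hm m h)
    rw [Finset.sum_insert hmM, Finset.card_insert_of_notMem hmM, qInt_succ, ← ih, Finset.mul_sum]
    congr 1
    · congr 1
      rw [Finset.filter_insert, Finset.filter_insert, if_neg (lt_irrefl _), if_neg (lt_irrefl _),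
        Finset.filter_true_of_mem hm, Finset.filter_false_of_mem fun x hx => (hm x hx).not_gt]
      simp
    · refine Finset.sum_congr rfl fun k hk => ?_
      rw [← T_add]; congr 1
      rw [Finset.filter_insert, Finset.filter_insert, if_neg (hm k hk).not_gt, if_pos (hm k hk),
        Finset.card_insert_of_notMem (by simp [hmM])]
      push_cast; ring

lemma nA_eq (J A : Finset ℤ) : nA J A = ∑ a ∈ A, ((J \ A).filter (· < a)).card := by
  unfold nA
  rw [Finset.card_filter, Finset.sum_product]
  simp only [Finset.card_filter]

lemma nA_insert {J A : Finset ℤ} {k : ℤ} (hk : k ∈ J \ A) :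
    nA J (insert k A) + (A.filter (k < ·)).card = nA J A + ((J \ A).filter (· < k)).card := by
  have hk' := Finset.mem_sdiff.1 hk
  rw [nA_eq, nA_eq, Finset.sum_insert hk'.2, Finset.card_filter (fun x => k < x)]
  have e : J \ insert k A = (J \ A).erase k := by
    ext x; simp; tauto
  rw [e]
  have h1 : ∀ a, (((J \ A).erase k).filter (· < a)).card + (if k < a then 1 else 0)
      = ((J \ A).filter (· < a)).card := by
    intro a
    rw [Finset.card_filter, Finset.card_filter, ← Finset.sum_erase_add _ _ hk]
  have h2 := h1 k
  rw [if_neg (lt_irrefl _), add_zero] at h2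
  rw [h2, add_assoc, ← Finset.sum_add_distrib, Finset.sum_congr rfl fun a _ => h1 a, add_comm]

section K
variable {t : ℕ} (K : Fin t → ℤ × ℤ)

def ub (B : Finset (Fin t)) (s : Fin t) : ℤ := if s ∈ B then (K s).1 else (K s).2

def Ub (B : Finset (Fin t)) : Finset ℤ := Finset.univ.image (ub K B)

def PP (J : Finset ℤ) : Finset ℤ :=
  J ∪ (Finset.univ.image (fun s => (K s).1) ∪ Finset.univ.image (fun s => (K s).2))

lemma UpSet_eq (A : Finset ℤ) (B : Finset (Fin t)) :
    UpSet A B K = ((A ∪ Ub K B : Finset ℤ) : Set ℤ) := by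
  ext x
  simp only [UpSet, Ub, ub, Set.mem_union, Finset.mem_coe, Set.mem_ofPred_eq, Finset.mem_union,
    Finset.mem_image, Finset.mem_univ, true_and]
  constructor
  · rintro ((h | ⟨s, h, rfl⟩) | ⟨s, h, rfl⟩)
    · exact Or.inl h
    · exact Or.inr ⟨s, by simp [h]⟩
    · exact Or.inr ⟨s, by simp [h]⟩
  · rintro (h | ⟨s, h⟩)
    · exact Or.inl (Or.inl h)
    · by_cases hs : s ∈ B
      · rw [if_pos hs] at h; exact Or.inl (Or.inr ⟨s, hs, h.symm⟩)
      · rw [if_neg hs] at h; exact Or.inr ⟨s, hs, h.symm⟩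

lemma Ub_sub (J A : Finset ℤ) (hA : A ⊆ J) (B : Finset (Fin t)) : A ∪ Ub K B ⊆ PP K J := by
  intro x hx
  simp only [Ub, ub, PP, Finset.mem_union, Finset.mem_image, Finset.mem_univ, true_and] at hx ⊢
  rcases hx with h | ⟨s, h⟩
  · exact Or.inl (hA h)
  · split_ifs at h
    · exact Or.inr (Or.inl ⟨s, h⟩)
    · exact Or.inr (Or.inr ⟨s, h⟩)

def dl (s : Fin t) (k : ℤ) : ℤ := if (K s).1 ≤ k ∧ k < (K s).2 then -1 else 0

variable {K} {J : Finset ℤ}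
    (hKlt : ∀ s, (K s).1 < (K s).2)
    (hJK : ∀ s, (K s).1 ∉ J ∧ (K s).2 ∉ J)
    (hKK : ∀ s s', s ≠ s' →
      (K s).1 ≠ (K s').1 ∧ (K s).1 ≠ (K s').2 ∧ (K s).2 ≠ (K s').1 ∧ (K s).2 ≠ (K s').2)

include hKlt hJK hKK in
lemma mem1 {A : Finset ℤ} (hA : A ⊆ J) (B : Finset (Fin t)) (s : Fin t) :
    (K s).1 ∈ A ∪ Ub K B ↔ s ∈ B := by
  simp only [Ub, ub, Finset.mem_union, Finset.mem_image, Finset.mem_univ, true_and]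
  constructor
  · rintro (h | ⟨s', h⟩)
    · exact absurd (hA h) (hJK s).1
    · by_cases e : s' = s
      · subst e
        by_contra hB
        rw [if_neg hB] at h
        exact (hKlt s').ne' h
      · split_ifs at h
        · exact absurd h (hKK _ _ e).1
        · exact absurd h (hKK _ _ e).2.2.1
  · intro h; exact Or.inr ⟨s, if_pos h⟩

include hKlt hJK hKK in
lemma mem2 {A : Finset ℤ} (hA : A ⊆ J) (B : Finset (Fin t)) (s : Fin t) :
    (K s).2 ∈ A ∪ Ub K B ↔ s ∉ B := by
  simp only [Ub, ub, Finset.mem_union, Finset.mem_image, Finset.mem_univ, true_and]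
  constructor
  · rintro (h | ⟨s', h⟩)
    · exact absurd (hA h) (hJK s).2
    · by_cases e : s' = s
      · subst e
        intro hB
        rw [if_pos hB] at h
        exact (hKlt s').ne h
      · split_ifs at h
        · exact absurd h (hKK _ _ e).2.1
        · exact absurd h (hKK _ _ e).2.2.2
  · intro h; exact Or.inr ⟨s, if_neg h⟩

include hJK in
lemma memJ (A : Finset ℤ) (B : Finset (Fin t)) {x : ℤ} (hx : x ∈ J) :
    x ∈ A ∪ Ub K B ↔ x ∈ A := by
  simp only [Ub, ub, Finset.mem_union, Finset.mem_image, Finset.mem_univ, true_and]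
  constructor
  · rintro (h | ⟨s', h⟩)
    · exact h
    · split_ifs at h
      · exact absurd (h ▸ hx) (hJK s').1
      · exact absurd (h ▸ hx) (hJK s').2
  · exact Or.inl

include hKlt hKK in
lemma ub_inj (B : Finset (Fin t)) : Function.Injective (ub K B) := by
  intro s s' h
  by_contra e
  obtain ⟨a, b, c, d⟩ := hKK s s' e
  unfold ub at h
  split_ifs at h <;> contradiction

include hKlt hJK hKK in
lemma sg_eq {A : Finset ℤ} (hA : A ⊆ J) (B : Finset (Fin t)) (k : ℤ) :
    sg (PP K J) (A ∪ Ub K B) k = sg J A k + ∑ s, (if s ∈ B then 1 else -1) * dl K s k := by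
  have i1 : Function.Injective (fun s => (K s).1) := fun s s' h => by
    by_contra e; exact (hKK s s' e).1 h
  have i2 : Function.Injective (fun s => (K s).2) := fun s s' h => by
    by_contra e; exact (hKK s s' e).2.2.2 h
  unfold sg PP
  rw [Finset.sum_union, Finset.sum_union, Finset.sum_image i1.injOn, Finset.sum_image i2.injOn,
    ← Finset.sum_add_distrib]
  · congr 1
    · refine Finset.sum_congr rfl fun x hx => ?_
      simp only [memJ hJK A B hx]
    · refine Finset.sum_congr rfl fun s _ => ?_
      simp only [mem1 hKlt hJK hKK hA B s, mem2 hKlt hJK hKK hA B s, dl]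
      have := hKlt s
      split_ifs <;> first | rfl | omega
  · rw [Finset.disjoint_left]
    intro x h1 h2
    simp only [Finset.mem_image, Finset.mem_univ, true_and] at h1 h2
    obtain ⟨s, rfl⟩ := h1
    obtain ⟨s', h⟩ := h2
    by_cases e : s' = s
    · subst e; exact (hKlt s').ne' h
    · exact (hKK _ _ e).2.2.1 h
  · rw [Finset.disjoint_left]
    intro x h1 h2
    simp only [Finset.mem_image, Finset.mem_univ, true_and, Finset.mem_union] at h2
    rcases h2 with ⟨s, rfl⟩ | ⟨s, rfl⟩
    · exact (hJK s).1 h1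
    · exact (hJK s).2 h1

include hKlt hJK hKK in
/-- The pair contributions cancel. -/
lemma cancel (hnoJ : ∀ s, ∀ j ∈ J, ¬((K s).1 ≤ j ∧ j ≤ (K s).2))
    (hnest : ∀ s s', s ≠ s' →
      Disjoint (Set.Icc (K s).1 (K s).2) (Set.Icc (K s').1 (K s').2) ∨
      Set.Icc (K s).1 (K s).2 ⊆ Set.Icc (K s').1 (K s').2 ∨
      Set.Icc (K s').1 (K s').2 ⊆ Set.Icc (K s).1 (K s).2)
    {A : Finset ℤ} (hA : A ⊆ J) (s : Fin t) (g : Finset ℤ → TD) :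
    ∑ B : Finset (Fin t), ((-T 1 : LaurentPolynomial ℤ) ^ B.card *
      T (sg (PP K J) (A ∪ Ub K B) (ub K B s))) • g ((A ∪ Ub K B).erase (ub K B s)) = 0 := by
  have hd : ∀ s' ≠ s, dl K s' (K s).1 = dl K s' (K s).2 := by
    intro s' e
    have hs := hKlt s
    have hs' := hKlt s'
    obtain ⟨a, b, c, d⟩ := hKK s' s e
    unfold dl
    rcases hnest s' s e with h | h | h
    · rw [Set.disjoint_left] at h
      have h1 := @h (K s).1
      have h2 := @h (K s').1
      simp only [Set.mem_Icc] at h1 h2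
      split_ifs <;> omega
    · rw [Set.Icc_subset_Icc_iff hs'.le] at h
      split_ifs <;> omega
    · rw [Set.Icc_subset_Icc_iff hs.le] at h
      split_ifs <;> omega
  have hsg : sg J A (K s).1 = sg J A (K s).2 := by
    unfold sg
    refine Finset.sum_congr rfl fun x hx => ?_
    have := hnoJ s x hx
    have h2 := hKlt s
    have : ((K s).1 < x ↔ (K s).2 < x) := by constructor <;> intro <;> omega
    simp only [this]
  rw [← Finset.powerset_univ, ← Finset.insert_erase (Finset.mem_univ s),
    Finset.sum_powerset_insert (by simp), ← Finset.sum_add_distrib]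
  refine Finset.sum_eq_zero fun B hB => ?_
  have hsB : s ∉ B := fun h => by
    have := Finset.mem_powerset.1 hB h
    simp at this
  have u1 : ub K B s = (K s).2 := if_neg hsB
  have u2 : ub K (insert s B) s = (K s).1 := if_pos (Finset.mem_insert_self _ _)
  have hsetE : (A ∪ Ub K B).erase (K s).2 = (A ∪ Ub K (insert s B)).erase (K s).1 := by
    have key : ∀ (B' : Finset (Fin t)) (x : ℤ), (x ∈ (A ∪ Ub K B').erase (ub K B' s)) ↔
        (x ∈ A ∨ ∃ s' ≠ s, ub K B' s' = x) := by
      intro B' x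
      simp only [Finset.mem_erase, Finset.mem_union, Ub, Finset.mem_image, Finset.mem_univ,
        true_and]
      constructor
      · rintro ⟨h1, h2 | ⟨s', rfl⟩⟩
        · exact Or.inl h2
        · exact Or.inr ⟨s', fun e => h1 (e ▸ rfl), rfl⟩
      · rintro (h | ⟨s', h, rfl⟩)
        · refine ⟨?_, Or.inl h⟩
          rintro rfl
          have := hA h
          unfold ub at this
          split_ifs at this
          · exact (hJK s).1 this
          · exact (hJK s).2 this
        · exact ⟨fun e => h (ub_inj hKlt hKK B' e), Or.inr ⟨s', rfl⟩⟩
    rw [← u1, ← u2]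
    ext x
    rw [key, key]
    refine or_congr Iff.rfl (exists_congr fun s' => and_congr_right fun hs' => ?_)
    unfold ub
    simp [hs']
  rw [u1, u2, hsetE, ← add_smul, Finset.card_insert_of_notMem hsB,
    sg_eq hKlt hJK hKK hA, sg_eq hKlt hJK hKK hA, ← hsg,
    ← Finset.add_sum_erase _ _ (Finset.mem_univ s), ← Finset.add_sum_erase _ _ (Finset.mem_univ s)]
  have hsum : ∑ x ∈ Finset.univ.erase s, (if x ∈ insert s B then (1 : ℤ) else -1) * dl K x (K s).1
      = ∑ x ∈ Finset.univ.erase s, (if x ∈ B then (1 : ℤ) else -1) * dl K x (K s).2 := by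
    refine Finset.sum_congr rfl fun x hx => ?_
    have hx' := Finset.ne_of_mem_erase hx
    rw [hd x hx']
    simp [hx']
  have d1 : dl K s (K s).1 = -1 := by unfold dl; rw [if_pos ⟨le_rfl, hKlt s⟩]
  have d2 : dl K s (K s).2 = 0 := by unfold dl; rw [if_neg]; exact fun h => lt_irrefl _ h.2
  rw [hsum, d1, d2, if_neg hsB, if_pos (Finset.mem_insert_self _ _)]
  generalize ∑ x ∈ Finset.univ.erase s, (if x ∈ B then (1 : ℤ) else -1) * dl K x (K s).2 = c
  have : (T (sg J A (K s).1 + (-1 * 0 + c)) : LaurentPolynomial ℤ)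
      = T 1 * T (sg J A (K s).1 + (1 * -1 + c)) := by
    rw [← T_add]; congr 1; ring
  rw [this, pow_succ]
  have hz : ∀ (a : LaurentPolynomial ℤ) (y : TD), a = 0 → a • y = 0 := by
    rintro a y rfl; exact zero_smul _ _
  apply hz
  ring

end K

lemma smallest_sub (J : Finset ℤ) (l : ℕ) : smallest J l ⊆ J := by
  intro x hx
  unfold smallest at hx
  rw [List.mem_toFinset] at hx
  simpa using List.mem_of_mem_take hx

lemma smallest_card (J : Finset ℤ) {l : ℕ} (hl : l ≤ J.card) : (smallest J l).card = l := by
  unfold smallest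
  rw [List.toFinset_card_of_nodup]
  · simp [hl]
  · exact (Finset.sort_nodup J _).sublist (List.take_sublist _ _)

lemma sg_J {J A : Finset ℤ} (hA : A ⊆ J) (k : ℤ) :
    sg J A k = ((A.filter (k < ·)).card : ℤ) - (((J \ A).filter (k < ·)).card : ℤ) := by
  unfold sg
  rw [← Finset.sum_sdiff hA, add_comm, sub_eq_add_neg, Finset.card_filter, Finset.card_filter]
  push_cast
  rw [← Finset.sum_neg_distrib]
  congr 1
  · refine Finset.sum_congr rfl fun x hx => ?_
    simp [hx]
  · refine Finset.sum_congr rfl fun x hx => ?_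
    rw [if_neg (Finset.mem_sdiff.1 hx).2]
    split_ifs <;> simp

theorem statement0 (n D : ℕ) (hn : 0 < n) (hD : 0 < D)
    (p : ℤ → ℤ) (hp : IsPD n D p) (i : ℤ) (hi0 : 0 ≤ i) (hin : i ≤ (n : ℤ) - 1)
    (hempty : ∀ k : ℤ, p k ≠ i + 1)
    (J : Finset ℤ) (t : ℕ) (K : Fin t → ℤ × ℤ)
    -- each `K_s = {k_s, l_s}` with `k_s < l_s` has exactly two elements
    (hKlt : ∀ s, (K s).1 < (K s).2)
    -- `J, K_1, …, K_t` cover `𝔭⁻¹(i)` …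
    (hcover : ∀ x : ℤ, p x = i ↔ (x ∈ J ∨ ∃ s, x = (K s).1 ∨ x = (K s).2))
    -- … and are pairwise disjoint
    (hJK : ∀ s, (K s).1 ∉ J ∧ (K s).2 ∉ J)
    (hKK : ∀ s s', s ≠ s' →
      (K s).1 ≠ (K s').1 ∧ (K s).1 ≠ (K s').2 ∧ (K s).2 ≠ (K s').1 ∧ (K s).2 ≠ (K s').2)
    -- no element of `J` lies in the interval `[k_s, l_s]`
    (hnoJ : ∀ s, ∀ j ∈ J, ¬((K s).1 ≤ j ∧ j ≤ (K s).2))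
    -- for `s ≠ s'` the intervals are disjoint or nested
    (hnest : ∀ s s', s ≠ s' →
      Disjoint (Set.Icc (K s).1 (K s).2) (Set.Icc (K s').1 (K s').2) ∨
      Set.Icc (K s).1 (K s).2 ⊆ Set.Icc (K s').1 (K s').2 ∨
      Set.Icc (K s').1 (K s').2 ⊆ Set.Icc (K s).1 (K s).2)
    (l : ℕ) (hl : l ≤ J.card) :
    Eop D i (bracket D (pl D p i J K l) i J K) =
      qInt (J.card - l + 1) •
        (if l = 0 then 0 else bracket D (pl D p i J K (l - 1)) i J K) := by
  have hP : ∀ x, p x = i ↔ x ∈ PP K J := by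
    intro x
    rw [hcover x]
    simp only [PP, Finset.mem_union, Finset.mem_image, Finset.mem_univ, true_and, exists_or,
      eq_comm]
  have hbr : ∀ l ≤ J.card, bracket D (pl D p i J K l) i J K =
      ∑ A ∈ J.powersetCard l, ∑ B : Finset (Fin t),
        ((T (nA J A : ℤ) : LaurentPolynomial ℤ) * (-T 1) ^ B.card) •
          bas (pAB D p i ((A ∪ Ub K B : Finset ℤ) : Set ℤ)) := by
    intro l hl
    have hW : ∀ x ∈ ((smallest J l : Finset ℤ) : Set ℤ) ∪ {x | ∃ s, x = (K s).2}, p x = i := by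
      rintro x (hx | ⟨s, rfl⟩)
      · exact (hcover x).2 (Or.inl (smallest_sub J l (by exact_mod_cast hx)))
      · exact (hcover _).2 (Or.inr ⟨s, Or.inr rfl⟩)
    have hf : (J.filter fun x => pl D p i J K l x = i + 1) = smallest J l := by
      ext x
      unfold pl
      rw [Finset.mem_filter, q_eq_succ hn hp hempty hW]
      constructor
      · rintro ⟨h, h' | ⟨s, rfl⟩⟩
        · exact_mod_cast h'
        · exact absurd h (hJK s).2
      · intro h
        exact ⟨smallest_sub J l h, Or.inl (by exact_mod_cast h)⟩
    unfold bracket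
    rw [hf, smallest_card J hl]
    have : J.powerset.filter (fun A => A.card = l) = J.powersetCard l := by
      ext A; simp [Finset.mem_powersetCard]
    rw [this]
    refine Finset.sum_congr rfl fun A hA => Finset.sum_congr rfl fun B _ => ?_
    rw [UpSet_eq]
    unfold pl
    rw [q_q hn hp hempty hW]
    intro x hx
    exact (hP x).2 (Ub_sub K J A (Finset.mem_powersetCard.1 hA).1 B (by exact_mod_cast hx))
  rw [hbr l hl]
  simp only [Eop_sum, Eop_smul_bas]
  -- reduce to the sum over elements of J
  have step : ∀ A ∈ J.powersetCard l, ∑ B : Finset (Fin t),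
      ((T (nA J A : ℤ) : LaurentPolynomial ℤ) * (-T 1) ^ B.card) •
        fE D i (pAB D p i ((A ∪ Ub K B : Finset ℤ) : Set ℤ)) =
      ∑ k ∈ A, (T ((nA J A : ℤ) + sg J A k) : LaurentPolynomial ℤ) •
        ∑ B : Finset (Fin t), ((-T 1) ^ B.card : LaurentPolynomial ℤ) •
          bas (pAB D p i ((A.erase k ∪ Ub K B : Finset ℤ) : Set ℤ)) := by
    intro A hA
    have hAJ := (Finset.mem_powersetCard.1 hA).1
    have hdis : ∀ B, Disjoint A (Ub K B) := by
      intro B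
      rw [Finset.disjoint_left]
      intro x hx hx'
      simp only [Ub, ub, Finset.mem_image, Finset.mem_univ, true_and] at hx'
      obtain ⟨s, rfl⟩ := hx'
      have := hAJ hx
      split_ifs at this
      · exact (hJK s).1 this
      · exact (hJK s).2 this
    have e1 : ∀ B : Finset (Fin t),
        ((T (nA J A : ℤ) : LaurentPolynomial ℤ) * (-T 1) ^ B.card) •
          fE D i (pAB D p i ((A ∪ Ub K B : Finset ℤ) : Set ℤ)) =
        ∑ k ∈ A, (T ((nA J A : ℤ) + sg J A k) : LaurentPolynomial ℤ) •
          ((-T 1) ^ B.card : LaurentPolynomial ℤ) •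
          bas (pAB D p i ((A.erase k ∪ Ub K B : Finset ℤ) : Set ℤ)) +
        (T (nA J A : ℤ) : LaurentPolynomial ℤ) • ∑ s, ((-T 1 : LaurentPolynomial ℤ) ^ B.card *
          T (sg (PP K J) (A ∪ Ub K B) (ub K B s))) •
            bas (pAB D p i (((A ∪ Ub K B).erase (ub K B s) : Finset ℤ) : Set ℤ)) := by
      intro B
      rw [fE_q hn hp hempty hP (Ub_sub K J A hAJ B), Finset.sum_union (hdis B), smul_add]
      congr 1
      · rw [Finset.smul_sum]
        refine Finset.sum_congr rfl fun k hk => ?_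
        have z : ∀ s, dl K s k = 0 := by
          intro s
          unfold dl
          rw [if_neg]
          intro h
          exact hnoJ s k (hAJ hk) ⟨h.1, h.2.le⟩
        have hk' : (A ∪ Ub K B).erase k = A.erase k ∪ Ub K B := by
          rw [Finset.erase_union_distrib,
            Finset.erase_eq_of_notMem (Finset.disjoint_left.1 (hdis B) hk)]
        rw [sg_eq hKlt hJK hKK hAJ, hk', smul_smul, smul_smul]
        simp only [z, mul_zero, Finset.sum_const_zero, add_zero, T_add]
        congr 1
        ring
      · rw [mul_smul, Finset.smul_sum]
        congr 1
        rw [show Ub K B = Finset.univ.image (ub K B) from rfl,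
          Finset.sum_image (ub_inj hKlt hKK B).injOn]
        refine Finset.sum_congr rfl fun s _ => ?_
        rw [smul_smul]
    simp only [e1]
    rw [Finset.sum_add_distrib, ← Finset.smul_sum, Finset.sum_comm (t := (Finset.univ : Finset (Fin t))),
      Finset.sum_eq_zero (s := (Finset.univ : Finset (Fin t))) fun s _ =>
        cancel hKlt hJK hKK hnoJ hnest hAJ s
          (fun U => bas (pAB D p i ((U : Finset ℤ) : Set ℤ))),
      smul_zero, add_zero, Finset.sum_comm]
    refine Finset.sum_congr rfl fun k _ => ?_
    rw [Finset.smul_sum]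
  rw [Finset.sum_congr rfl step]
  by_cases hl0 : l = 0
  · subst hl0
    simp
  rw [if_neg hl0, hbr (l - 1) (by omega)]
  set G : Finset ℤ → TD := fun A => ∑ B : Finset (Fin t), ((-T 1) ^ B.card : LaurentPolynomial ℤ) •
          bas (pAB D p i ((A ∪ Ub K B : Finset ℤ) : Set ℤ)) with hG
  have r : ∀ A : Finset ℤ, ∑ B : Finset (Fin t),
        ((T (nA J A : ℤ) : LaurentPolynomial ℤ) * (-T 1) ^ B.card) •
          bas (pAB D p i ((A ∪ Ub K B : Finset ℤ) : Set ℤ)) =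
        (T (nA J A : ℤ) : LaurentPolynomial ℤ) • G A := by
    intro A
    rw [hG, Finset.smul_sum]
    simp only [mul_smul]
  simp only [r]
  rw [Finset.smul_sum]
  have r2 : ∀ A' ∈ J.powersetCard (l - 1),
      qInt (J.card - l + 1) • (T (nA J A' : ℤ) : LaurentPolynomial ℤ) • G A' =
      ∑ k ∈ J \ A', (T ((nA J (insert k A') : ℤ) + sg J (insert k A') k) : LaurentPolynomial ℤ) •
        G A' := by
    intro A' hA'
    obtain ⟨h1, h2⟩ := Finset.mem_powersetCard.1 hA'
    have hc : J.card - l + 1 = (J \ A').card := by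
      rw [Finset.card_sdiff_of_subset h1]; omega
    rw [hc, ← sum_qInt, ← Finset.sum_smul, smul_smul, Finset.sum_mul]
    congr 1
    refine Finset.sum_congr rfl fun k hk => ?_
    rw [← T_add]
    congr 1
    have hk' := Finset.mem_sdiff.1 hk
    have e := nA_insert hk
    rw [sg_J (Finset.insert_subset hk'.1 h1)]
    have f1 : (insert k A').filter (k < ·) = A'.filter (k < ·) := by
      rw [Finset.filter_insert, if_neg (lt_irrefl _)]
    have f2 : (J \ insert k A').filter (k < ·) = (J \ A').filter (k < ·) := by
      ext x
      simp only [Finset.mem_filter, Finset.mem_sdiff, Finset.mem_insert]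
      constructor
      · rintro ⟨⟨a, b⟩, c⟩; exact ⟨⟨a, fun h => b (Or.inr h)⟩, c⟩
      · rintro ⟨⟨a, b⟩, c⟩; exact ⟨⟨a, by rintro (h | h); exacts [c.ne' h, b h]⟩, c⟩
    rw [f1, f2]
    omega
  rw [Finset.sum_congr rfl r2, Finset.sum_sigma', Finset.sum_sigma']
  refine Finset.sum_bij' (fun x _ => ⟨x.1.erase x.2, x.2⟩) (fun x _ => ⟨insert x.2 x.1, x.2⟩)
    ?_ ?_ ?_ ?_ ?_
  · rintro ⟨A, k⟩ h
    simp only [Finset.mem_sigma, Finset.mem_powersetCard, Finset.mem_sdiff] at h ⊢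
    refine ⟨⟨(Finset.erase_subset _ _).trans h.1.1, ?_⟩, h.1.1 h.2, by simp⟩
    rw [Finset.card_erase_of_mem h.2, h.1.2]
  · rintro ⟨A, k⟩ h
    simp only [Finset.mem_sigma, Finset.mem_powersetCard, Finset.mem_sdiff] at h ⊢
    refine ⟨⟨Finset.insert_subset h.2.1 h.1.1, ?_⟩, by simp⟩
    rw [Finset.card_insert_of_notMem h.2.2, h.1.2]; omega
  · rintro ⟨A, k⟩ h
    simp only [Finset.mem_sigma] at h
    simp [Finset.insert_erase h.2]
  · rintro ⟨A, k⟩ h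
    simp only [Finset.mem_sigma, Finset.mem_sdiff] at h
    simp [Finset.erase_insert h.2.2]
  · rintro ⟨A, k⟩ h
    simp only [Finset.mem_sigma] at h
    simp only [Finset.insert_erase h.2, hG]
end
end

section
/- For every 𝔭 ∈ 𝔓_D and every i ∈ {0,…,n−1}, an admissible partition of P = 𝔭^{-1}({i,i+1}) exists, and it is unique up to renumbering the pairs: the subset J and the collection of two-element sets {K_1,…,K_t} are uniquely determined by 𝔭 and i. -/
/-- `J, K_1, …, K_t` (with `K_s = {(K s).1, (K s).2}`, `(K s).1 < (K s).2`) is an admissible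
partition of `𝔭⁻¹({i,i+1})`. -/
def IsAdmissible (p : ℤ → ℤ) (i : ℤ) (J : Finset ℤ) {t : ℕ} (K : Fin t → ℤ × ℤ) : Prop :=
  -- (a) each `K_s` has exactly two elements, listed in increasing order
  (∀ s, (K s).1 < (K s).2) ∧
  -- `J, K_1, …, K_t` cover `P = 𝔭⁻¹({i,i+1})` …
  (∀ x : ℤ, (p x = i ∨ p x = i + 1) ↔ (x ∈ J ∨ ∃ s, x = (K s).1 ∨ x = (K s).2)) ∧
  -- … and are pairwise disjoint
  (∀ s, (K s).1 ∉ J ∧ (K s).2 ∉ J) ∧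
  (∀ s s', s ≠ s' →
    (K s).1 ≠ (K s').1 ∧ (K s).1 ≠ (K s').2 ∧ (K s).2 ≠ (K s').1 ∧ (K s).2 ≠ (K s').2) ∧
  -- (b) consecutive elements `k < l` of `J` never satisfy `(𝔭(k),𝔭(l)) = (i,i+1)`
  (∀ k ∈ J, ∀ l ∈ J, k < l → (∀ j ∈ J, ¬(k < j ∧ j < l)) → ¬(p k = i ∧ p l = i + 1)) ∧
  -- (c) `(𝔭(k_s),𝔭(l_s)) = (i,i+1)` …
  (∀ s, p (K s).1 = i ∧ p (K s).2 = i + 1) ∧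
  -- … and no element of `J` lies in the interval `[k_s, l_s]`
  (∀ s, ∀ j ∈ J, ¬((K s).1 ≤ j ∧ j ≤ (K s).2)) ∧
  -- (d) for `s ≠ s'` the intervals are disjoint or nested
  (∀ s s', s ≠ s' →
    Disjoint (Set.Icc (K s).1 (K s).2) (Set.Icc (K s').1 (K s').2) ∨
    Set.Icc (K s).1 (K s).2 ⊆ Set.Icc (K s').1 (K s').2 ∨
    Set.Icc (K s').1 (K s').2 ⊆ Set.Icc (K s).1 (K s).2)


structure AdmAux (o : ℤ → Prop) (P J : Finset ℤ) (M : Finset (ℤ × ℤ)) : Prop where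
  lt : ∀ k l, (k, l) ∈ M → k < l ∧ k ∈ P ∧ l ∈ P ∧ o k ∧ ¬ o l ∧ k ∉ J ∧ l ∉ J
  cov : ∀ x ∈ P, x ∈ J ∨ ∃ y, (x, y) ∈ M ∨ (y, x) ∈ M
  sub : ∀ x ∈ J, x ∈ P
  dj : ∀ k l k' l', (k, l) ∈ M → (k', l') ∈ M → (k, l) ≠ (k', l') →
    k ≠ k' ∧ k ≠ l' ∧ l ≠ k' ∧ l ≠ l'
  cons : ∀ k ∈ J, ∀ l ∈ J, k < l → (∀ j ∈ J, ¬(k < j ∧ j < l)) → ¬(o k ∧ ¬ o l)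
  out : ∀ k l, (k, l) ∈ M → ∀ j ∈ J, ¬ (k ≤ j ∧ j ≤ l)
  nc : ∀ k l k' l', (k, l) ∈ M → (k', l') ∈ M → (k, l) ≠ (k', l') →
    l < k' ∨ l' < k ∨ (k' ≤ k ∧ l ≤ l') ∨ (k ≤ k' ∧ l' ≤ l)

def ConsAux (o : ℤ → Prop) (P : Finset ℤ) (k l : ℤ) : Prop :=
  k ∈ P ∧ l ∈ P ∧ k < l ∧ o k ∧ ¬ o l ∧ ∀ j ∈ P, ¬ (k < j ∧ j < l)

theorem consAux_exists (o : ℤ → Prop) (P : Finset ℤ) : ∀ (N : ℕ) (k l : ℤ),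
    l - k ≤ N → k ∈ P → l ∈ P → k < l → o k → ¬ o l → ∃ k l, ConsAux o P k l := by
  intro N
  induction N with
  | zero => intro k l h _ _ h2; push_cast at h; omega
  | succ N ih =>
    intro k l h hk hl hlt ho hc
    by_cases hj : ∀ j ∈ P, ¬ (k < j ∧ j < l)
    · exact ⟨k, l, hk, hl, hlt, ho, hc, hj⟩
    · push Not at hj
      obtain ⟨j, hjP, h1, h2⟩ := hj
      push_cast at h
      by_cases hoj : o j
      · exact ih j l (by omega) hjP hl h2 hoj hc
      · exact ih k j (by omega) hk hjP h1 ho hoj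

theorem AdmAux.mem {o : ℤ → Prop} {P J : Finset ℤ} {M : Finset (ℤ × ℤ)} (h : AdmAux o P J M)
    {k l : ℤ} (hc : ConsAux o P k l) : (k, l) ∈ M := by
  obtain ⟨hk, hl, hlt, ho, hno, hj⟩ := hc
  rcases h.cov k hk with hkJ | ⟨y, hy | hy⟩
  · rcases h.cov l hl with hlJ | ⟨z, hz | hz⟩
    · exact absurd ⟨ho, hno⟩ (h.cons k hkJ l hlJ hlt (fun j hjJ => hj j (h.sub j hjJ)))
    · exact absurd (h.lt _ _ hz).2.2.2.1 hno
    · have a := h.lt _ _ hz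
      have b := h.out _ _ hz k hkJ
      have c := hj z a.2.1
      have d : z ≠ k := by rintro rfl; exact a.2.2.2.2.2.1 hkJ
      omega
  · have a := h.lt _ _ hy
    by_cases hyl : y = l
    · exact hyl ▸ hy
    have c := hj y a.2.2.1
    rcases h.cov l hl with hlJ | ⟨z, hz | hz⟩
    · have b := h.out _ _ hy l hlJ
      omega
    · exact absurd (h.lt _ _ hz).2.2.2.1 hno
    · have a' := h.lt _ _ hz
      have c' := hj z a'.2.1
      have hne : (k, y) ≠ (z, l) := by simp [hyl]
      have := h.nc _ _ _ _ hy hz hne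
      have := h.dj _ _ _ _ hy hz hne
      omega
  · exact absurd ho (h.lt _ _ hy).2.2.2.2.1

theorem AdmAux.remove {o : ℤ → Prop} {P J : Finset ℤ} {M : Finset (ℤ × ℤ)} (h : AdmAux o P J M)
    {k l : ℤ} (hm : (k, l) ∈ M) : AdmAux o ((P.erase k).erase l) J (M.erase (k, l)) := by
  have a := h.lt _ _ hm
  refine ⟨?_, ?_, ?_, ?_, h.cons, ?_, ?_⟩
  · intro k' l' hm'
    rw [Finset.mem_erase] at hm'
    have b := h.lt _ _ hm'.2
    have c := h.dj _ _ _ _ hm'.2 hm hm'.1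
    simp only [Finset.mem_erase]
    tauto
  · intro x hx
    simp only [Finset.mem_erase] at hx
    rcases h.cov x hx.2.2 with h1 | ⟨y, hy | hy⟩
    · exact Or.inl h1
    · refine Or.inr ⟨y, Or.inl ?_⟩
      simp [hy, hx.2.1]
    · refine Or.inr ⟨y, Or.inr ?_⟩
      simp [hy, hx.1]
  · intro x hx
    simp only [Finset.mem_erase]
    refine ⟨?_, ?_, h.sub x hx⟩
    · rintro rfl; tauto
    · rintro rfl; tauto
  · intro k1 l1 k2 l2 h1 h2
    exact h.dj _ _ _ _ (Finset.mem_of_mem_erase h1) (Finset.mem_of_mem_erase h2)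
  · intro k1 l1 h1
    exact h.out _ _ (Finset.mem_of_mem_erase h1)
  · intro k1 l1 k2 l2 h1 h2
    exact h.nc _ _ _ _ (Finset.mem_of_mem_erase h1) (Finset.mem_of_mem_erase h2)

theorem AdmAux.add_pair {o : ℤ → Prop} {P J : Finset ℤ} {M : Finset (ℤ × ℤ)}
    {k l : ℤ} (hc : ConsAux o P k l) (h : AdmAux o ((P.erase k).erase l) J M) :
    AdmAux o P J (insert (k, l) M) := by
  obtain ⟨hk, hl, hlt, ho, hno, hj⟩ := hc
  have hP : ∀ x, x ∈ (P.erase k).erase l → x ∈ P ∧ x ≠ k ∧ x ≠ l ∧ (x < k ∨ l < x) := by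
    intro x hx
    simp only [Finset.mem_erase] at hx
    have := hj x hx.2.2
    refine ⟨hx.2.2, hx.2.1, hx.1, ?_⟩
    omega
  have hM : ∀ k' l', (k', l') ∈ M → k' < l' ∧ (k' < k ∨ l < k') ∧ (l' < k ∨ l < l') := by
    intro k' l' hm
    have a := h.lt _ _ hm
    exact ⟨a.1, (hP _ a.2.1).2.2.2, (hP _ a.2.2.1).2.2.2⟩
  have hJ : ∀ x ∈ J, x < k ∨ l < x := fun x hx => (hP x (h.sub x hx)).2.2.2
  refine ⟨?_, ?_, fun x hx => (hP x (h.sub x hx)).1, ?_, h.cons, ?_, ?_⟩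
  · intro k' l' hm
    rw [Finset.mem_insert, Prod.mk.injEq] at hm
    rcases hm with ⟨rfl, rfl⟩ | hm
    · refine ⟨hlt, hk, hl, ho, hno, ?_, ?_⟩
      · intro hx; have := hJ _ hx; omega
      · intro hx; have := hJ _ hx; omega
    · have a := h.lt _ _ hm
      have b := hP _ a.2.1
      have c := hP _ a.2.2.1
      tauto
  · intro x hx
    by_cases hxk : x = k
    · exact Or.inr ⟨l, Or.inl (by simp [hxk])⟩
    by_cases hxl : x = l
    · exact Or.inr ⟨k, Or.inr (by simp [hxl])⟩
    rcases h.cov x (by simp [hxk, hxl, hx]) with h1 | ⟨y, hy⟩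
    · exact Or.inl h1
    · refine Or.inr ⟨y, ?_⟩
      simp only [Finset.mem_insert]
      tauto
  · intro k1 l1 k2 l2 h1 h2 hne
    rw [Finset.mem_insert, Prod.mk.injEq] at h1 h2
    rcases h1 with ⟨rfl, rfl⟩ | h1 <;> rcases h2 with ⟨rfl, rfl⟩ | h2
    · exact absurd rfl hne
    · have := hM _ _ h2; omega
    · have := hM _ _ h1; omega
    · exact h.dj _ _ _ _ h1 h2 hne
  · intro k1 l1 h1 j hjJ
    rw [Finset.mem_insert, Prod.mk.injEq] at h1
    rcases h1 with ⟨rfl, rfl⟩ | h1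
    · have := hJ j hjJ; omega
    · exact h.out _ _ h1 j hjJ
  · intro k1 l1 k2 l2 h1 h2 hne
    rw [Finset.mem_insert, Prod.mk.injEq] at h1 h2
    rcases h1 with ⟨rfl, rfl⟩ | h1 <;> rcases h2 with ⟨rfl, rfl⟩ | h2
    · exact absurd rfl hne
    · have := hM _ _ h2; omega
    · have := hM _ _ h1; omega
    · exact h.nc _ _ _ _ h1 h2 hne

theorem admAux_main (o : ℤ → Prop) : ∀ (N : ℕ) (P : Finset ℤ), P.card ≤ N →
    ∃ J M, AdmAux o P J M ∧ ∀ J' M', AdmAux o P J' M' → J' = J ∧ M' = M := by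
  intro N
  induction N with
  | zero =>
    intro P hP
    have : P = ∅ := by simpa using hP
    subst this
    refine ⟨∅, ∅, ⟨by simp, by simp, by simp, by simp, by simp, by simp, by simp⟩, ?_⟩
    intro J' M' h
    refine ⟨Finset.eq_empty_of_forall_notMem fun x hx => by simpa using h.sub x hx,
      Finset.eq_empty_of_forall_notMem fun x hx => by simpa using (h.lt x.1 x.2 hx).2.1⟩
  | succ N ih =>
    intro P hP
    by_cases hc : ∃ k l, ConsAux o P k l
    · obtain ⟨k, l, hc⟩ := hc
      have hlt : ((P.erase k).erase l).card ≤ N := by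
        have h1 := Finset.card_erase_lt_of_mem hc.1
        have h2 := Finset.card_le_card (Finset.erase_subset l (P.erase k))
        omega
      obtain ⟨J, M, hA, hu⟩ := ih _ hlt
      refine ⟨J, insert (k, l) M, AdmAux.add_pair hc hA, ?_⟩
      intro J' M' h'
      have hm := h'.mem hc
      obtain ⟨e1, e2⟩ := hu _ _ (h'.remove hm)
      exact ⟨e1, by rw [← e2, Finset.insert_erase hm]⟩
    · have hn : ∀ k ∈ P, ∀ l ∈ P, k < l → ¬ (o k ∧ ¬ o l) := by
        intro k hk l hl hlt ⟨h1, h2⟩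
        exact hc (consAux_exists o P (l - k).toNat k l (by omega) hk hl hlt h1 h2)
      refine ⟨P, ∅, ⟨by simp, fun x hx => Or.inl hx, fun x hx => hx, by simp,
        fun k hk l hl hlt _ => hn k hk l hl hlt, by simp, by simp⟩, ?_⟩
      intro J' M' h
      have hM : M' = ∅ := Finset.eq_empty_of_forall_notMem fun x hx => by
        have a := h.lt x.1 x.2 hx
        exact hn _ a.2.1 _ a.2.2.1 a.1 ⟨a.2.2.2.1, a.2.2.2.2.1⟩
      subst hM
      refine ⟨Finset.Subset.antisymm h.sub fun x hx => ?_, rfl⟩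
      simpa using h.cov x hx

theorem finite_fiberAux (n D : ℕ) (hn : 0 < n) (hD : 0 < D)
    (p : ℤ → ℤ) (hp : IsPD n D p) (i : ℤ) : {x | p x = i}.Finite := by
  have hN : ∀ (q : ℕ) (j : ℤ), p (j + D * q) = p j + n * q := by
    intro q
    induction q with
    | zero => simp
    | succ q ih =>
      intro j
      have := hp (j + D * q)
      rw [ih] at this
      push_cast
      rw [show j + (D : ℤ) * (q + 1) = j + D * q + D by ring, this]
      ring
  have hne : ∀ x y : ℤ, p x = i → p y = i → x % D = y % D → x ≤ y → x = y := by
    intro x y hx hy hm hle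
    have hd : (D : ℤ) ∣ y - x := Int.ModEq.dvd hm
    obtain ⟨q, hq⟩ := hd
    have hD' : (0 : ℤ) < D := by exact_mod_cast hD
    have hq0 : 0 ≤ q := by
      by_contra hneg
      push Not at hneg
      nlinarith
    lift q to ℕ using hq0
    have := hN q x
    rw [show x + (D : ℤ) * q = y by linarith, hx, hy] at this
    have h0 : (n : ℤ) * q = 0 := by linarith
    have : (q : ℤ) = 0 := by
      rcases mul_eq_zero.mp h0 with h | h
      · omega
      · exact h
    rw [this] at hq
    linarith
  refine Set.Finite.of_injOn (f := fun x : ℤ => x % D) (t := Set.Ico (0 : ℤ) D) ?_ ?_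
    (Set.finite_Ico _ _)
  · intro x _
    exact ⟨Int.emod_nonneg _ (by omega), Int.emod_lt_of_pos _ (by omega)⟩
  · intro x hx y hy hxy
    rcases le_total x y with h | h
    · exact hne x y hx hy hxy h
    · exact (hne y x hy hx hxy.symm h).symm

theorem ncAux {a b c d : ℤ} (h1 : a < b) (h2 : c < d) :
    (Disjoint (Set.Icc a b) (Set.Icc c d) ∨ Set.Icc a b ⊆ Set.Icc c d ∨
      Set.Icc c d ⊆ Set.Icc a b) ↔
    (b < c ∨ d < a ∨ (c ≤ a ∧ b ≤ d) ∨ (a ≤ c ∧ d ≤ b)) := by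
  rw [Set.Icc_subset_Icc_iff h1.le, Set.Icc_subset_Icc_iff h2.le]
  have : Disjoint (Set.Icc a b) (Set.Icc c d) ↔ (b < c ∨ d < a) := by
    rw [Set.disjoint_left]
    constructor
    · intro h
      by_contra hcon
      have := @h (max a c)
      simp only [Set.mem_Icc] at this
      omega
    · intro h x hx hx'
      simp only [Set.mem_Icc] at hx hx'
      omega
  rw [this]
  tauto

theorem admissible_toAux {p : ℤ → ℤ} {i : ℤ} {P : Finset ℤ}
    (hP : ∀ x, x ∈ P ↔ (p x = i ∨ p x = i + 1)) {J : Finset ℤ} {t : ℕ} {K : Fin t → ℤ × ℤ}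
    (h : IsAdmissible p i J K) :
    Function.Injective K ∧ AdmAux (fun x => p x = i) P J (Finset.univ.image K) := by
  obtain ⟨h1, h2, h3, h4, h5, h6, h7, h8⟩ := h
  have hJ : ∀ x ∈ J, x ∈ P := fun x hx => (hP x).2 ((h2 x).2 (Or.inl hx))
  have hmem : ∀ k l, (k, l) ∈ Finset.univ.image K → ∃ s, K s = (k, l) := by
    intro k l hm
    simpa using hm
  refine ⟨?_, ?_, ?_, hJ, ?_, ?_, ?_, ?_⟩
  · intro s s' hs
    by_contra hne
    exact (h4 s s' hne).1 (by rw [hs])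
  · intro k l hm
    obtain ⟨s, hs⟩ := hmem k l hm
    have a1 := h1 s
    have a3 := h3 s
    have a6 := h6 s
    rw [hs] at a1 a3 a6
    simp only at a1 a3 a6
    refine ⟨a1, (hP k).2 (Or.inl a6.1), (hP l).2 (Or.inr a6.2), a6.1, ?_, a3.1, a3.2⟩
    simp only [a6.2]
    omega
  · intro x hx
    rcases (h2 x).1 ((hP x).1 hx) with h | ⟨s, rfl | rfl⟩
    · exact Or.inl h
    · exact Or.inr ⟨(K s).2, Or.inl (by simp)⟩
    · exact Or.inr ⟨(K s).1, Or.inr (by simp)⟩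
  · intro k l k' l' hm hm' hne
    obtain ⟨s, hs⟩ := hmem k l hm
    obtain ⟨s', hs'⟩ := hmem k' l' hm'
    have := h4 s s' (by rintro rfl; exact hne (hs.symm.trans hs'))
    rw [hs, hs'] at this
    exact this
  · intro k hk l hl hlt hj ⟨ho, hno⟩
    have := (hP l).1 (hJ l hl)
    exact h5 k hk l hl hlt hj ⟨ho, this.resolve_left hno⟩
  · intro k l hm
    obtain ⟨s, hs⟩ := hmem k l hm
    have := h7 s
    rw [hs] at this
    exact this
  · intro k l k' l' hm hm' hne
    obtain ⟨s, hs⟩ := hmem k l hm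
    obtain ⟨s', hs'⟩ := hmem k' l' hm'
    have a := h8 s s' (by rintro rfl; exact hne (hs.symm.trans hs'))
    rw [ncAux (h1 s) (h1 s'), hs, hs'] at a
    exact a

theorem admissible_ofAux {p : ℤ → ℤ} {i : ℤ} {P : Finset ℤ}
    (hP : ∀ x, x ∈ P ↔ (p x = i ∨ p x = i + 1)) {J : Finset ℤ} {t : ℕ} {K : Fin t → ℤ × ℤ}
    (hK : Function.Injective K) (h : AdmAux (fun x => p x = i) P J (Finset.univ.image K)) :
    IsAdmissible p i J K := by
  have hmem : ∀ s, ((K s).1, (K s).2) ∈ Finset.univ.image K := by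
    intro s
    simp
  have hL := fun s => h.lt _ _ (hmem s)
  refine ⟨fun s => (hL s).1, ?_, fun s => (hL s).2.2.2.2.2, ?_, ?_, ?_, ?_, ?_⟩
  · intro x
    rw [← hP]
    constructor
    · intro hx
      rcases h.cov x hx with h' | ⟨y, hy | hy⟩
      · exact Or.inl h'
      · obtain ⟨s, hs⟩ : ∃ s, K s = (x, y) := by simpa using hy
        exact Or.inr ⟨s, Or.inl (by rw [hs])⟩
      · obtain ⟨s, hs⟩ : ∃ s, K s = (y, x) := by simpa using hy
        exact Or.inr ⟨s, Or.inr (by rw [hs])⟩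
    · rintro (h' | ⟨s, rfl | rfl⟩)
      · exact h.sub x h'
      · exact (hL s).2.1
      · exact (hL s).2.2.1
  · intro s s' hne
    exact h.dj _ _ _ _ (hmem s) (hmem s') (fun e => hne (hK e))
  · intro k hk l hl hlt hj ⟨ho, hc⟩
    refine h.cons k hk l hl hlt hj ⟨ho, ?_⟩
    simp only [hc]
    omega
  · intro s
    have a := hL s
    refine ⟨a.2.2.2.1, ?_⟩
    exact ((hP _).1 a.2.2.1).resolve_left a.2.2.2.2.1
  · intro s
    exact h.out _ _ (hmem s)
  · intro s s' hne
    rw [ncAux (hL s).1 (hL s').1]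
    exact h.nc _ _ _ _ (hmem s) (hmem s') (fun e => hne (hK e))

theorem statement2 (n D : ℕ) (hn : 0 < n) (hD : 0 < D)
    (p : ℤ → ℤ) (hp : IsPD n D p) (i : ℤ) (hi0 : 0 ≤ i) (hin : i ≤ (n : ℤ) - 1) :
    ∃ (J : Finset ℤ) (t : ℕ) (K : Fin t → ℤ × ℤ), IsAdmissible p i J K ∧
      ∀ (J' : Finset ℤ) (t' : ℕ) (K' : Fin t' → ℤ × ℤ), IsAdmissible p i J' K' →
        J' = J ∧ ∃ σ : Fin t' ≃ Fin t, ∀ s, K' s = K (σ s) := by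
  have hfin := (finite_fiberAux n D hn hD p hp i).union (finite_fiberAux n D hn hD p hp (i + 1))
  obtain ⟨P, hP⟩ : ∃ P : Finset ℤ, ∀ x, x ∈ P ↔ (p x = i ∨ p x = i + 1) :=
    ⟨hfin.toFinset, fun x => by simp⟩
  obtain ⟨J, M, hA, hu⟩ := admAux_main (fun x => p x = i) P.card P le_rfl
  let K : Fin M.card → ℤ × ℤ := fun s => (M.equivFin.symm s : ℤ × ℤ)
  have hK : Function.Injective K := Subtype.val_injective.comp M.equivFin.symm.injective
  have hKM : Finset.univ.image K = M := by
    ext x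
    simp only [Finset.mem_image, Finset.mem_univ, true_and]
    constructor
    · rintro ⟨s, rfl⟩
      exact (M.equivFin.symm s).2
    · intro hx
      exact ⟨M.equivFin ⟨x, hx⟩, by simp [K]⟩
  refine ⟨J, M.card, K, admissible_ofAux hP hK (hKM.symm ▸ hA), ?_⟩
  intro J' t' K' h'
  obtain ⟨hK', hA'⟩ := admissible_toAux hP h'
  obtain ⟨e1, e2⟩ := hu _ _ hA'
  refine ⟨e1, ?_⟩
  rw [← hKM] at e2
  have hex : ∀ s, ∃ r, K r = K' s := by
    intro s
    have : K' s ∈ Finset.univ.image K := by rw [← e2]; simp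
    simpa using this
  choose f hf using hex
  have hb : Function.Bijective f := by
    constructor
    · intro a b hab
      apply hK'
      rw [← hf a, ← hf b, hab]
    · intro r
      have : K r ∈ Finset.univ.image K' := by rw [e2]; simp
      obtain ⟨s, hs⟩ : ∃ s, K' s = K r := by simpa using this
      exact ⟨s, hK (by rw [hf, hs])⟩
  exact ⟨Equiv.ofBijective f hb, fun s => (hf s).symm⟩
end

section
/- Let 𝔭 ∈ 𝔓_D, i ∈ {0,…,n−1}, and fix an admissible partition J, K_1, …, K_t of 𝔭^{-1}({i,i+1}). Then ⟨𝔭⟩ − [𝔭] lies in v·L_D, where L_D denotes the ℤ[v]-submodule of T_D spanned by the basis elements [𝔮], 𝔮 ∈ 𝔓_D. Equivalently, in the expansion of ⟨𝔭⟩ in the basis {[𝔮]}, the coefficient of [𝔭] is 1 and all other coefficients lie in v·ℤ[v]. -/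
open LaurentPolynomial

open scoped Classical

noncomputable section

theorem nA_eq_zero_iff' (J A : Finset ℤ) : nA J A = 0 ↔ ∀ k ∈ A, ∀ l ∈ J, l ∉ A → k ≤ l := by
  unfold nA
  rw [Finset.card_eq_zero, Finset.filter_eq_empty_iff]
  constructor
  · intro h k hk l hl hlA
    have := @h (k, l) (by simp [hk, hl, hlA])
    simpa using this
  · rintro h ⟨k, l⟩ hx
    simp only [Finset.mem_product, Finset.mem_sdiff] at hx
    have := h k hx.1 l hx.2.1 hx.2.2
    simpa using this

theorem nA_zero_base (J : Finset ℤ) (p : ℤ → ℤ) (i : ℤ)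
    (hJ : ∀ x ∈ J, p x = i ∨ p x = i + 1)
    (hconsec : ∀ k ∈ J, ∀ m ∈ J, k < m → (∀ j ∈ J, ¬(k < j ∧ j < m)) →
      ¬(p k = i ∧ p m = i + 1)) :
    nA J (J.filter fun x => p x = i + 1) = 0 := by
  rw [nA_eq_zero_iff']
  intro k hk l hl hlA
  by_contra! hlt
  simp only [Finset.mem_filter, not_and] at hk hlA
  obtain ⟨a, ha, hamax⟩ := (J.filter fun x => x < k ∧ p x = i).exists_max_image id
    ⟨l, by simp only [Finset.mem_filter]; exact ⟨hl, hlt, (hJ l hl).resolve_right (hlA hl)⟩⟩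
  simp only [Finset.mem_filter, id] at ha hamax
  obtain ⟨m, hm, hmin⟩ := (J.filter fun x => a < x).exists_min_image id
    ⟨k, by simp only [Finset.mem_filter]; exact ⟨hk.1, ha.2.1⟩⟩
  simp only [Finset.mem_filter, id] at hm hmin
  have hmk := hmin k ⟨hk.1, ha.2.1⟩
  refine hconsec a ha.1 m hm.1 hm.2 (fun j hj hh => ?_) ⟨ha.2.2, ?_⟩
  · have := hmin j ⟨hj, hh.1⟩; omega
  · rcases hJ m hm.1 with h | h
    · rcases hmk.lt_or_eq with h1 | h1
      · have := hamax m ⟨hm.1, h1, h⟩; omega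
      · rw [h1]; exact hk.2
    · exact h

theorem eq_of_nA_zero (J A A' : Finset ℤ) (h1 : A ⊆ J) (h2 : A' ⊆ J) (hc : A.card = A'.card)
    (hA : nA J A = 0) (hA' : nA J A' = 0) : A = A' := by
  rw [nA_eq_zero_iff'] at hA hA'
  by_contra hne
  have hn1 : ¬ A ⊆ A' := fun h => hne (Finset.eq_of_subset_of_card_le h hc.ge)
  have hn2 : ¬ A' ⊆ A := fun h => hne (Finset.eq_of_subset_of_card_le h hc.le).symm
  obtain ⟨x, hx, hx'⟩ := Finset.not_subset.1 hn1
  obtain ⟨y, hy, hy'⟩ := Finset.not_subset.1 hn2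
  have e1 := hA x hx y (h2 hy) hy'
  have e2 := hA' y hy x (h1 hx) hx'
  have : x = y := le_antisymm e1 e2
  exact hx' (this ▸ hy)

theorem coeff_form (a b : ℕ) : ∃ f : Polynomial ℤ,
    ((T (a : ℤ) : LaurentPolynomial ℤ) * (-T 1) ^ b) =
      (if a = 0 ∧ b = 0 then 1 else 0) + T 1 * Polynomial.toLaurent f := by
  by_cases h : a = 0 ∧ b = 0
  · exact ⟨0, by simp [h.1, h.2]⟩
  · refine ⟨Polynomial.X ^ (a + b - 1) * (-1) ^ b, ?_⟩
    obtain ⟨c, hc⟩ : ∃ c, a + b = c + 1 := ⟨a + b - 1, by omega⟩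
    rw [if_neg h, zero_add, hc, neg_pow, T_pow]
    simp only [map_mul, map_pow, map_neg, map_one, Polynomial.toLaurent_X, T_pow]
    rw [mul_left_comm, ← T_add, ← mul_assoc, ← T_add, mul_comm]
    congr 2
    push_cast
    simp
    omega

theorem statement3 (n D : ℕ) (hn : 0 < n) (hD : 0 < D)
    (p : ℤ → ℤ) (hp : IsPD n D p) (i : ℤ) (hi0 : 0 ≤ i) (hin : i ≤ (n : ℤ) - 1)
    (J : Finset ℤ) (t : ℕ) (K : Fin t → ℤ × ℤ)
    -- (a) each `K_s = {k_s, l_s}` with `k_s < l_s` has exactly two elements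
    (hKlt : ∀ s, (K s).1 < (K s).2)
    -- `J, K_1, …, K_t` cover `P = 𝔭⁻¹({i,i+1})` …
    (hcover : ∀ x : ℤ, (p x = i ∨ p x = i + 1) ↔ (x ∈ J ∨ ∃ s, x = (K s).1 ∨ x = (K s).2))
    -- … and are pairwise disjoint
    (hJK : ∀ s, (K s).1 ∉ J ∧ (K s).2 ∉ J)
    (hKK : ∀ s s', s ≠ s' →
      (K s).1 ≠ (K s').1 ∧ (K s).1 ≠ (K s').2 ∧ (K s).2 ≠ (K s').1 ∧ (K s).2 ≠ (K s').2)
    -- (b) consecutive elements `k < l` of `J` never satisfy `(𝔭(k),𝔭(l)) = (i,i+1)`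
    (hconsec : ∀ k ∈ J, ∀ m ∈ J, k < m → (∀ j ∈ J, ¬(k < j ∧ j < m)) →
      ¬(p k = i ∧ p m = i + 1))
    -- (c) `(𝔭(k_s),𝔭(l_s)) = (i,i+1)` …
    (hpair : ∀ s, p (K s).1 = i ∧ p (K s).2 = i + 1)
    -- … and no element of `J` lies in the interval `[k_s, l_s]`
    (hnoJ : ∀ s, ∀ j ∈ J, ¬((K s).1 ≤ j ∧ j ≤ (K s).2))
    -- (d) for `s ≠ s'` the intervals are disjoint or nested
    (hnest : ∀ s s', s ≠ s' →
      Disjoint (Set.Icc (K s).1 (K s).2) (Set.Icc (K s').1 (K s').2) ∨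
      Set.Icc (K s).1 (K s).2 ⊆ Set.Icc (K s').1 (K s').2 ∨
      Set.Icc (K s').1 (K s').2 ⊆ Set.Icc (K s).1 (K s).2) :
    -- `⟨𝔭⟩ − [𝔭] ∈ v·L_D` : the difference is `v` times an element all of whose
    -- coefficients are (ordinary, non-Laurent) polynomials in `v`
    ∃ r : TD, bracket D p i J K = bas p + (T 1 : LaurentPolynomial ℤ) • r ∧
      ∀ q : ℤ → ℤ, ∃ f : Polynomial ℤ, r q = Polynomial.toLaurent f := by
  have hJ : ∀ x ∈ J, p x = i ∨ p x = i + 1 := fun x hx => (hcover x).2 (Or.inl hx)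
  set A0 := J.filter fun x => p x = i + 1 with hA0
  have h0 : nA J A0 = 0 := nA_zero_base J p i hJ hconsec
  have hbase : pAB D p i (UpSet A0 (∅ : Finset (Fin t)) K) = p := by
    funext j
    have e1 : ¬ ∃ k ∈ UpSet A0 (∅ : Finset (Fin t)) K, p k = i ∧ (D : ℤ) ∣ (j - k) := by
      rintro ⟨k, hk, hki, -⟩
      have : p k = i + 1 := by
        rcases hk with (hk | ⟨s, hs, -⟩) | ⟨s, -, rfl⟩
        · exact (Finset.mem_filter.1 (Finset.mem_coe.1 hk)).2
        · simp at hs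
        · exact (hpair s).2
      omega
    have e2 : ¬ ∃ k, p k = i + 1 ∧ k ∉ UpSet A0 (∅ : Finset (Fin t)) K ∧ (D : ℤ) ∣ (j - k) := by
      rintro ⟨k, hk, hkU, -⟩
      apply hkU
      rcases (hcover k).1 (Or.inr hk) with h | ⟨s, h | h⟩
      · exact Or.inl (Or.inl (Finset.mem_coe.2 (Finset.mem_filter.2 ⟨h, hk⟩)))
      · have := (hpair s).1
        rw [← h] at this
        omega
      · exact Or.inr ⟨s, by simp, h⟩
    unfold pAB
    rw [if_neg e1, if_neg e2]
    ring
  choose f hf using coeff_form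
  refine ⟨∑ A ∈ J.powerset.filter (fun A => A.card = A0.card), ∑ B : Finset (Fin t),
    Polynomial.toLaurent (f (nA J A) B.card) • bas (pAB D p i (UpSet A B K)), ?_, ?_⟩
  · unfold bracket
    simp only [hf, add_smul, Finset.sum_add_distrib, Finset.smul_sum, mul_smul]
    congr 1
    rw [Finset.sum_eq_single_of_mem A0, Finset.sum_eq_single_of_mem ∅ (Finset.mem_univ _)]
    · simp [h0, hbase]
    · intro B _ hB
      rw [if_neg (by simp [hB]), zero_smul]
    · simp [hA0]
    · intro A hA hne
      simp only [Finset.mem_filter, Finset.mem_powerset] at hA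
      refine Finset.sum_eq_zero fun B _ => ?_
      rw [if_neg, zero_smul]
      rintro ⟨h, -⟩
      exact hne (eq_of_nA_zero J A A0 hA.1 (Finset.filter_subset _ _) hA.2 h h0)
  · intro q
    refine ⟨∑ A ∈ J.powerset.filter (fun A => A.card = A0.card), ∑ B : Finset (Fin t),
      if pAB D p i (UpSet A B K) = q then f (nA J A) B.card else 0, ?_⟩
    simp only [Finsupp.finset_sum_apply, map_sum, bas, Finsupp.smul_apply, Finsupp.single_apply]
    refine Finset.sum_congr rfl fun A _ => Finset.sum_congr rfl fun B _ => ?_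
    split_ifs <;> simp
end
end

section
/- Assume n ≥ 2. Fix i ∈ ℤ and μ ∈ ℕ^n with μ_i ≥ 1 (indices of μ read modulo n). Let D_μ be the ℤ×ℤ matrix with entries (D_μ)_{kl} = δ_{kl}·μ_k; let 𝔰 be the matrix with entries 𝔰_{kl} = (D_μ)_{kl} − δ_{kl}·[k ≡ i mod n] + δ_{l,k+1}·[k ≡ i mod n]; and let 𝔱 be the transpose of 𝔰, i.e. 𝔱_{kl} = 𝔰_{lk}. Then y_{D_μ} = 0, y_𝔰 = μ_i − 1, and y_𝔱 = μ_{i+1}. -/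
open scoped Classical

noncomputable section

/-- `y_𝔞 = Σ 𝔞_{ab}·𝔞_{cd}`, the sum over all quadruples `(a,b,c,d)` with `a ≥ c`, `b < d`
and `1 ≤ a ≤ n` (a finite sum for the matrices considered here, computed with `finsum`). -/
def ymat (n : ℕ) (a : ℤ → ℤ → ℤ) : ℤ :=
  ∑ᶠ q : (ℤ × ℤ) × ℤ × ℤ,
    if q.2.1 ≤ q.1.1 ∧ q.1.2 < q.2.2 ∧ 1 ≤ q.1.1 ∧ q.1.1 ≤ (n : ℤ) then
      a q.1.1 q.1.2 * a q.2.1 q.2.2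
    else 0

/-- The diagonal matrix `D_μ` with `(D_μ)_{kl} = δ_{kl}·μ_k`. -/
def Dmu (μ : ℤ → ℕ) (k l : ℤ) : ℤ := if k = l then (μ k : ℤ) else 0

/-- The matrix `𝔰` with `𝔰_{kl} = (D_μ)_{kl} − δ_{kl}·[k ≡ i mod n] + δ_{l,k+1}·[k ≡ i mod n]`. -/
def smat (n : ℕ) (i : ℤ) (μ : ℤ → ℕ) (k l : ℤ) : ℤ :=
  Dmu μ k l - (if k = l ∧ (n : ℤ) ∣ (k - i) then 1 else 0)
    + (if l = k + 1 ∧ (n : ℤ) ∣ (k - i) then 1 else 0)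

theorem aux_rep (n : ℕ) (hn : 2 ≤ n) (i : ℤ) :
    ∃ r : ℤ, 1 ≤ r ∧ r ≤ n ∧ (n : ℤ) ∣ (r - i) ∧
      ∀ k : ℤ, 1 ≤ k → k ≤ n → (n : ℤ) ∣ (k - i) → k = r := by
  have hn0 : (0 : ℤ) < n := by omega
  have h1 := Int.emod_nonneg (i - 1) hn0.ne'
  have h2 := Int.emod_lt_of_pos (i - 1) hn0
  have h3 := Int.emod_add_mul_ediv (i - 1) n
  have hd : (n : ℤ) ∣ ((i - 1) % n + 1 - i) := ⟨-((i - 1) / n), by linarith⟩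
  refine ⟨(i - 1) % n + 1, by omega, by omega, hd, ?_⟩
  intro k hk1 hk2 hk
  have h := dvd_sub hk hd
  have h0 := Int.eq_zero_of_abs_lt_dvd h (by rw [abs_lt]; constructor <;> omega)
  omega

theorem aux_per (n : ℕ) (μ : ℤ → ℕ) (hμ : ∀ j : ℤ, μ (j + n) = μ j) (a b : ℤ)
    (h : (n : ℤ) ∣ (a - b)) : μ a = μ b := by
  obtain ⟨c, hc⟩ := h
  have hp : Function.Periodic μ (n : ℤ) := hμ
  have := hp.int_mul c b
  rw [← this]
  congr 1
  simp only [Int.cast_id]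
  linarith

theorem smat_diag (n : ℕ) (i : ℤ) (μ : ℤ → ℕ) (k : ℤ) :
    smat n i μ k k = μ k - (if (n : ℤ) ∣ (k - i) then 1 else 0) := by
  simp [smat, Dmu]

theorem smat_up (n : ℕ) (i : ℤ) (μ : ℤ → ℕ) (k : ℤ) :
    smat n i μ k (k + 1) = (if (n : ℤ) ∣ (k - i) then 1 else 0) := by
  simp [smat, Dmu]

theorem smat_supp (n : ℕ) (i : ℤ) (μ : ℤ → ℕ) (k l : ℤ) (h : smat n i μ k l ≠ 0) :
    l = k ∨ (l = k + 1 ∧ (n : ℤ) ∣ (k - i)) := by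
  by_contra hc
  push Not at hc
  apply h
  have h1 : ¬ (k = l) := fun e => hc.1 e.symm
  have h2 : ¬ (l = k + 1 ∧ (n : ℤ) ∣ (k - i)) := fun e => hc.2 e.1 e.2
  simp [smat, Dmu, h1, h2]

theorem statement10 (n : ℕ) (hn : 2 ≤ n) (i : ℤ) (μ : ℤ → ℕ)
    (hμ : ∀ j : ℤ, μ (j + n) = μ j) (hi : 1 ≤ μ i) :
    ymat n (Dmu μ) = 0 ∧
      ymat n (smat n i μ) = (μ i : ℤ) - 1 ∧
      ymat n (fun k l => smat n i μ l k) = (μ (i + 1) : ℤ) := by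
  refine ⟨?_, ?_, ?_⟩
  · unfold ymat
    rw [← finsum_zero (α := (ℤ × ℤ) × ℤ × ℤ)]
    congr 1
    funext ⟨⟨a, b⟩, c, d⟩
    simp only [Dmu]
    split_ifs <;> first | omega | simp
  · obtain ⟨r, hr1, hr2, hr, hu⟩ := aux_rep n hn i
    unfold ymat
    rw [finsum_eq_single _ ((r, r), (r, r + 1))]
    · simp [hr1, hr2, smat_diag, smat_up, hr, aux_per n μ hμ r i hr]
    · rintro ⟨⟨a, b⟩, c, d⟩ hne
      simp only
      split_ifs with hc
      · obtain ⟨h1, h2, h3, h4⟩ := hc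
        by_contra hz
        rcases smat_supp _ _ _ _ _ (left_ne_zero_of_mul hz) with e | ⟨e, he⟩ <;>
        rcases smat_supp _ _ _ _ _ (right_ne_zero_of_mul hz) with f | ⟨f, hf⟩ <;>
        try omega
        obtain rfl : c = a := by omega
        obtain rfl := hu c h3 h4 hf
        subst e f
        exact hne rfl
      · rfl
  · obtain ⟨r, hr1, hr2, hr, hu⟩ := aux_rep n hn (i + 1)
    have hr' : (n : ℤ) ∣ (r - 1 - i) := by
      have e : r - 1 - i = r - (i + 1) := by ring
      rwa [e]
    have hnd : ¬ (n : ℤ) ∣ (r - i) := by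
      intro h
      have h1 := dvd_sub h hr'
      have e : r - i - (r - 1 - i) = 1 := by ring
      rw [e] at h1
      have := Int.le_of_dvd one_pos h1
      omega
    have hup := smat_up n i μ (r - 1)
    rw [sub_add_cancel, if_pos hr'] at hup
    unfold ymat
    rw [finsum_eq_single _ ((r, r - 1), (r, r))]
    · simp [hr1, hr2, smat_diag, hup, hnd, aux_per n μ hμ r (i + 1) hr]
    · rintro ⟨⟨a, b⟩, c, d⟩ hne
      simp only
      split_ifs with hc
      · obtain ⟨h1, h2, h3, h4⟩ := hc
        by_contra hz
        rcases smat_supp _ _ _ _ _ (left_ne_zero_of_mul hz) with e | ⟨e, he⟩ <;>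
        rcases smat_supp _ _ _ _ _ (right_ne_zero_of_mul hz) with f | ⟨f, hf⟩ <;>
        try omega
        have hca : c = a := by omega
        have hb : b = a - 1 := by omega
        have har : a = r := by
          apply hu a h3 h4
          have e2 : a - (i + 1) = b - i := by omega
          rwa [e2]
        apply hne
        have hd : d = r := by omega
        rw [hb, hca, hd, har]
      · rfl
end
end
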